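/- Let n, n̄ ≥ 0, let A ∈ GL_n(ℚ), Ā ∈ GL_n̄(ℚ), and let L ≤ ℤ^n ∩ A⁻¹(ℤ^n) and L̄ ≤ ℤ^n̄ ∩ Ā⁻¹(ℤ^n̄) be finite-index subgroups. Suppose that G(A,L) ≅ G(Ā,L̄), that L ≠ ℤ^n and AL ≠ ℤ^n, and that L̄ ≠ ℤ^n̄ and ĀL̄ ≠ ℤ^n̄. Then n = n̄, and there exists B ∈ GL_n(ℤ) such that either Ā = BAB⁻¹ and L̄ = BL, or Ā = BA⁻¹B⁻¹ and L̄ = B(AL). -/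

import Mathlib

open Matrix

noncomputable section

/-- The coercion `ℤ^n → ℚ^n` as an additive homomorphism. -/
def ZtoQ (n : ℕ) : (Fin n → ℤ) →+ (Fin n → ℚ) :=
  AddMonoidHom.mk' (fun v i => (v i : ℚ)) (by intro a b; funext i; simp)

/-- The image `A·L ⊆ ℚ^n` of a subgroup `L ≤ ℤ^n` under the matrix `A`. -/
def QImage {n : ℕ} (A : Matrix (Fin n) (Fin n) ℚ) (L : AddSubgroup (Fin n → ℤ)) :
    AddSubgroup (Fin n → ℚ) :=
  (L.map (ZtoQ n)).map A.mulVecLin.toAddMonoidHom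

/-- The subgroup `AL` of `ℤ^n`, i.e. the set of integer vectors lying in `A·L`. -/
def ALsub {n : ℕ} (A : Matrix (Fin n) (Fin n) ℚ) (L : AddSubgroup (Fin n → ℤ)) :
    AddSubgroup (Fin n → ℤ) :=
  (QImage A L).comap (ZtoQ n)

/-- `x^v = x_1^{v_1} ⋯ x_n^{v_n}` in the free group on `x_1,…,x_n,t`. -/
def xWord (n : ℕ) (v : Fin n → ℤ) : FreeGroup (Fin n ⊕ Unit) :=
  (List.ofFn fun i => (FreeGroup.of (Sum.inl i) : FreeGroup (Fin n ⊕ Unit)) ^ (v i)).prod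

/-- The relations of the Leary–Minasyan group `G(A,L)`. -/
def LMrels (n : ℕ) (A : Matrix (Fin n) (Fin n) ℚ) (L : AddSubgroup (Fin n → ℤ)) :
    Set (FreeGroup (Fin n ⊕ Unit)) :=
  {r | (∃ i j : Fin n,
          r = FreeGroup.of (Sum.inl i) * FreeGroup.of (Sum.inl j) *
              (FreeGroup.of (Sum.inl i))⁻¹ * (FreeGroup.of (Sum.inl j))⁻¹) ∨
       (∃ v ∈ L, ∃ w : Fin n → ℤ, ZtoQ n w = A.mulVec (ZtoQ n v) ∧
          r = FreeGroup.of (Sum.inr ()) * xWord n v * (FreeGroup.of (Sum.inr ()))⁻¹ *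
              (xWord n w)⁻¹)}

/-- The Leary–Minasyan group `G(A,L)`. -/
abbrev LM (n : ℕ) (A : Matrix (Fin n) (Fin n) ℚ) (L : AddSubgroup (Fin n → ℤ)) :=
  PresentedGroup (LMrels n A L)

/-- The generator `x_i` of `G(A,L)`. -/
def Xg (n : ℕ) (A : Matrix (Fin n) (Fin n) ℚ) (L : AddSubgroup (Fin n → ℤ)) (i : Fin n) :
    LM n A L :=
  PresentedGroup.of (Sum.inl i)

/-- The stable letter `t` of `G(A,L)`. -/
def Tg (n : ℕ) (A : Matrix (Fin n) (Fin n) ℚ) (L : AddSubgroup (Fin n → ℤ)) : LM n A L :=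
  PresentedGroup.of (Sum.inr ())

/-- The element `x^v` of `G(A,L)`. -/
def Xv (n : ℕ) (A : Matrix (Fin n) (Fin n) ℚ) (L : AddSubgroup (Fin n → ℤ)) (v : Fin n → ℤ) :
    LM n A L :=
  (List.ofFn fun i => (Xg n A L i) ^ (v i)).prod

/-- The base subgroup `H = ⟨x_1,…,x_n⟩` of `G(A,L)`. -/
def Hsub (n : ℕ) (A : Matrix (Fin n) (Fin n) ℚ) (L : AddSubgroup (Fin n → ℤ)) :
    Subgroup (LM n A L) :=
  Subgroup.closure (Set.range (Xg n A L))

/-- The set `⋃_{j∈ℤ} A^j(ℤ^n) ⊆ ℚ^n`. -/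
def unionSet {n : ℕ} (A : Matrix (Fin n) (Fin n) ℚ) : Set (Fin n → ℚ) :=
  ⋃ j : ℤ, (A ^ j).mulVec '' Set.range (ZtoQ n)

/-- Cast an integer matrix to a rational matrix. -/
def QMat {k : ℕ} (M : Matrix (Fin k) (Fin k) ℤ) : Matrix (Fin k) (Fin k) ℚ :=
  M.map (Int.cast)

/-- The block matrix `[[1, 0ᵀ],[u, C]]`. -/
def blockOne {k : ℕ} (u : Fin k → ℤ) (C : Matrix (Fin k) (Fin k) ℤ) :
    Matrix (Fin (k+1)) (Fin (k+1)) ℤ :=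
  Matrix.of fun i j =>
    Fin.cases (Fin.cases 1 (fun _ => 0) j) (fun i' => Fin.cases (u i') (fun j' => C i' j') j) i

/-- Transport a subgroup of `ℤ^a` along an equality `a = b` of dimensions. -/
def reindexSub {a b : ℕ} (h : a = b) (L : AddSubgroup (Fin a → ℤ)) :
    AddSubgroup (Fin b → ℤ) :=
  L.map (AddMonoidHom.mk' (fun v => v ∘ (finCongr h).symm) (fun _ _ => rfl))

namespace HNNExtension

open NormalWord Multiplicative

section Words

variable {G : Type*} [Group G] {A B : Subgroup G} (φ : A ≃* B)

/-- The product `t ^ u₁ * g₁ * ⋯ * t ^ uₖ * gₖ` of a list of letters `(uᵢ, gᵢ)`. -/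
def letters (l : List (ℤˣ × G)) : HNNExtension G A B φ :=
  (l.map fun x => t ^ (x.1 : ℤ) * of x.2).prod

variable (A B) in
/-- A list of letters without a subword `t ^ u * g * t ^ (-u)` with `g ∈ toSubgroup A B u`. -/
abbrev Reduced (l : List (ℤˣ × G)) : Prop :=
  l.IsChain (fun a b => a.2 ∈ toSubgroup A B a.1 → a.1 = b.1)

@[simp]
theorem letters_nil : letters φ [] = 1 := rfl

@[simp]
theorem letters_cons (p : ℤˣ × G) (l : List (ℤˣ × G)) :
    letters φ (p :: l) = t ^ (p.1 : ℤ) * of p.2 * letters φ l := by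
  simp [letters]

@[simp]
theorem letters_append (l₁ l₂ : List (ℤˣ × G)) :
    letters φ (l₁ ++ l₂) = letters φ l₁ * letters φ l₂ := by
  simp [letters]

theorem exists_reduced (g : HNNExtension G A B φ) :
    ∃ h l, Reduced A B l ∧ g = of h * letters φ l := by
  obtain ⟨d⟩ := TransversalPair.nonempty G A B
  refine ⟨(g • (empty : NormalWord d)).head, (g • (empty : NormalWord d)).toList,
    (g • (empty : NormalWord d)).chain, ?_⟩
  have h := prod_smul φ g (empty : NormalWord d)
  rw [prod_empty, mul_one] at h
  exact h.symm

theorem reduced_unique {h₁ h₂ : G} {l₁ l₂ : List (ℤˣ × G)} (hl₁ : Reduced A B l₁)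
    (hl₂ : Reduced A B l₂) (h : of h₁ * letters φ l₁ = of h₂ * letters φ l₂) :
    l₁.map Prod.fst = l₂.map Prod.fst ∧
      ∀ u ∈ l₁.head?.map Prod.fst, h₁⁻¹ * h₂ ∈ toSubgroup A B (-u) :=
  ReducedWord.map_fst_eq_and_of_prod_eq φ (w₁ := ⟨h₁, l₁, hl₁⟩) (w₂ := ⟨h₂, l₂, hl₂⟩) h

/-- `g` is represented by a nonempty reduced list of letters whose first and last stable letters
have exponents `e` and `f`. -/
def IsRed (e f : ℤˣ) (g : HNNExtension G A B φ) : Prop :=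
  ∃ l, Reduced A B l ∧ e ∈ l.head?.map Prod.fst ∧ f ∈ l.getLast?.map Prod.fst ∧ g = letters φ l

theorem letters_isRed {l : List (ℤˣ × G)} (hl : Reduced A B l) (hne : l ≠ []) :
    IsRed φ (l.head hne).1 (l.getLast hne).1 (letters φ l) :=
  ⟨l, hl, by simp [List.head?_eq_some_head hne], by simp [List.getLast?_eq_some_getLast hne], rfl⟩

variable {φ}

theorem IsRed.mul_of {e f : ℤˣ} {g : HNNExtension G A B φ} (hg : IsRed φ e f g) (a : G) :
    IsRed φ e f (g * of a) := by
  obtain ⟨l, hl, he, hf, rfl⟩ := hg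
  rcases List.eq_nil_or_concat l with rfl | ⟨l, ⟨u, b⟩, rfl⟩
  · simp at he
  · refine ⟨l ++ [(u, b * a)], ?_, ?_, ?_, ?_⟩
    · simpa [Reduced, List.isChain_append] using hl
    · cases l <;> simpa using he
    · simpa using hf
    · simp [mul_assoc]

theorem IsRed.mul {e f f' : ℤˣ} {g g' : HNNExtension G A B φ} (hg : IsRed φ e f g)
    (hg' : IsRed φ f f' g') : IsRed φ e f' (g * g') := by
  obtain ⟨l, hl, he, hf, rfl⟩ := hg
  obtain ⟨l', hl', he', hf', rfl⟩ := hg'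
  refine ⟨l ++ l', List.isChain_append.2 ⟨hl, hl', ?_⟩, ?_, ?_, by simp⟩
  · intro x hx y hy _
    simp only [Option.mem_def] at *
    rw [hx] at hf
    rw [hy] at he'
    simp_all
  · cases l <;> simp_all
  · rcases List.eq_nil_or_concat l' with rfl | ⟨l', x, rfl⟩
    · simp at he'
    · simpa [← List.append_assoc] using hf'

theorem IsRed.unique {e f e' f' : ℤˣ} {g g' : HNNExtension G A B φ} (hg : IsRed φ e f g)
    (hg' : IsRed φ e' f' g') {a b : G} (h : of a * g = of b * g') :
    e = e' ∧ a⁻¹ * b ∈ toSubgroup A B (-e) := by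
  obtain ⟨l, hl, he, hf, rfl⟩ := hg
  obtain ⟨l', hl', he', hf', rfl⟩ := hg'
  obtain ⟨h1, h2⟩ := reduced_unique φ hl hl' h
  refine ⟨?_, h2 e he⟩
  rw [← List.head?_map] at he he'
  rw [h1] at he
  exact Option.mem_unique he he'

theorem isRed_t_of_t (e f : ℤˣ) {a : G} (ha : a ∉ toSubgroup A B e) :
    IsRed φ e f (t ^ (e : ℤ) * of a * t ^ (f : ℤ)) :=
  ⟨[(e, a), (f, 1)], by simp [ha], by simp, by simp, by simp⟩

theorem IsRed.pow {l : List (ℤˣ × G)} (hl : Reduced A B (l ++ l)) (hne : l ≠ []) {m : ℕ}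
    (hm : 0 < m) : IsRed φ (l.head hne).1 (l.getLast hne).1 (letters φ l ^ m) := by
  suffices H : ∀ m : ℕ, ∃ l' : List (ℤˣ × G), Reduced A B (l ++ l') ∧
      (l.getLast hne).1 ∈ (l ++ l').getLast?.map Prod.fst ∧
      letters φ l ^ (m + 1) = letters φ (l ++ l') by
    obtain ⟨m, rfl⟩ := Nat.exists_eq_succ_of_ne_zero hm.ne'
    obtain ⟨l', h1, h2, h3⟩ := H m
    exact ⟨l ++ l', h1, by simp [List.head?_append_of_ne_nil _ hne, List.head?_eq_some_head hne],
      h2, h3⟩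
  intro m
  induction m with
  | zero => exact ⟨[], by simpa using (List.isChain_append.1 hl).1,
      by simp [List.getLast?_eq_some_getLast hne], by simp⟩
  | succ m ih =>
    obtain ⟨l', h1, h2, h3⟩ := ih
    refine ⟨l ++ l', ?_, ?_, ?_⟩
    · rw [← List.append_assoc]
      exact List.IsChain.append_overlap hl h1 hne
    · rw [List.getLast?_append_of_ne_nil _ (by simp [hne])]
      exact h2
    · rw [pow_succ', h3, ← letters_append]

variable (φ)

theorem t_zpow_mul_of {u : ℤˣ} {a : G} (ha : a ∈ toSubgroup A B u) :
    (t ^ (u : ℤ) * of a : HNNExtension G A B φ) =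
      of (toSubgroupEquiv φ u ⟨a, ha⟩ : G) * t ^ (u : ℤ) := by
  rcases Int.units_eq_one_or u with rfl | rfl
  · rw [Units.val_one, zpow_one]
    exact t_mul_of (φ := φ) ⟨a, ha⟩
  · rw [Units.val_neg, Units.val_one, _root_.zpow_neg, zpow_one]
    exact inv_t_mul_of (φ := φ) ⟨a, ha⟩

/-- Every element is conjugate into the base group or to a cyclically reduced product. -/
theorem exists_conj_cyclicallyReduced (g : HNNExtension G A B φ) :
    (∃ x h, x * g * x⁻¹ = of h) ∨
      ∃ x l, l ≠ [] ∧ Reduced A B (l ++ l) ∧ x * g * x⁻¹ = letters φ l := by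
  obtain ⟨h, l, hl, rfl⟩ := exists_reduced φ g
  induction hn : l.length using Nat.strong_induction_on generalizing h l with
  | _ n ih =>
    rcases List.eq_nil_or_concat l with rfl | ⟨l', ⟨u, b⟩, rfl⟩
    · exact Or.inl ⟨1, h, by simp⟩
    by_cases hcyc : Reduced A B ((l' ++ [(u, b * h)]) ++ (l' ++ [(u, b * h)]))
    · exact Or.inr ⟨(of h)⁻¹, _, by simp, hcyc, by simp [mul_assoc]⟩
    rcases l' with _ | ⟨⟨v, c⟩, l'⟩
    · simp [Reduced] at hcyc
    have hred : Reduced A B (((v, c) :: l') ++ [(u, b * h)]) := by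
      rw [List.concat_eq_append] at hl
      refine List.isChain_append.2 ⟨(List.isChain_append.1 hl).1, by simp, ?_⟩
      simpa using (List.isChain_append.1 hl).2.2
    have hbad : b * h ∈ toSubgroup A B u ∧ u ≠ v := by
      by_contra hcon
      refine hcyc (List.isChain_append.2 ⟨hred, hred, ?_⟩)
      intro x hx y hy
      rw [List.getLast?_concat, Option.mem_some_iff] at hx
      simp only [List.cons_append, List.head?_cons, Option.mem_some_iff] at hy
      subst hx hy
      simpa using hcon
    obtain ⟨hmem, huv⟩ := hbad
    have hv : (v : ℤ) = -(u : ℤ) := by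
      rcases Int.units_eq_one_or u with rfl | rfl <;>
        rcases Int.units_eq_one_or v with rfl | rfl <;> simp_all
    have hl' : Reduced A B l' := (List.isChain_append.1 hred).1.tail
    have key : (t ^ (u : ℤ) * of (b * h)) * (of h)⁻¹ *
        (of h * letters φ (((v, c) :: l').concat (u, b))) *
          ((t ^ (u : ℤ) * of (b * h)) * (of h)⁻¹)⁻¹ =
        of ((toSubgroupEquiv φ u ⟨b * h, hmem⟩ : G) * c) * letters φ l' := by
      rw [t_zpow_mul_of φ hmem]
      simp only [List.concat_eq_append, letters_append, letters_cons, letters_nil, hv, map_mul,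
        List.cons_append]
      have e := t_zpow_mul_of φ hmem
      have e2 : (t ^ (u : ℤ) * of b : HNNExtension G A B φ) =
        of (toSubgroupEquiv φ u ⟨b * h, hmem⟩ : G) * t ^ (u : ℤ) * (of h)⁻¹ := by
        rw [← e]; simp [mul_assoc]
      rw [e2]
      group
    specialize ih l'.length (by simp at hn; omega)
      ((toSubgroupEquiv φ u ⟨b * h, hmem⟩ : G) * c) l' hl' rfl
    rw [← key] at ih
    rcases ih with ⟨x, k, hx⟩ | ⟨x, k, hk, hk', hx⟩
    · exact Or.inl ⟨x * ((t ^ (u : ℤ) * of (b * h)) * (of h)⁻¹), k, by rw [← hx]; group⟩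
    · exact Or.inr ⟨x * ((t ^ (u : ℤ) * of (b * h)) * (of h)⁻¹), k, hk, hk', by rw [← hx]; group⟩

end Words

section Elliptic

variable {G : Type*} [CommGroup G] {A B : Subgroup G} {φ : A ≃* B}

theorem notMem_toSubgroup {a : G} (hA : a ∉ A) (hB : a ∉ B) (u : ℤˣ) :
    a ∉ toSubgroup A B u := by
  rcases Int.units_eq_one_or u with rfl | rfl <;> simpa

/-- An element of the base group outside both associated subgroups fixes only one vertex of the
Bass–Serre tree. -/
theorem mem_range_of_conj {a b : G} (hA : a ∉ A) (hB : a ∉ B) {x : HNNExtension G A B φ}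
    (h : x * of a * x⁻¹ = of b) : ∃ c, x = of c := by
  obtain ⟨c, l, hl, hx⟩ := exists_reduced φ x⁻¹
  by_cases hne : l = []
  · exact ⟨c⁻¹, by rw [← inv_inv x, hx]; simp [hne]⟩
  have hr := letters_isRed φ hl hne
  have e : of c * (letters φ l * of b) = of (a * c) * letters φ l := by
    rw [map_mul, ← mul_assoc, mul_assoc (of a), ← hx, ← h]; group
  have := ((hr.mul_of b).unique hr e).2
  rw [mul_comm a, inv_mul_cancel_left] at this
  exact absurd this (notMem_toSubgroup hA hB _)

/-- Elements not conjugate into the base group have, in the Bass–Serre tree, an axis that some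
group element moves. -/
theorem exists_not_commute {a : G} (hA : a ∉ A) (hB : a ∉ B) {g : HNNExtension G A B φ}
    (hg : ¬ ∃ x h, x * g * x⁻¹ = of h) :
    ∃ x, ∀ m : ℕ, 0 < m → ¬ Commute (x * g ^ m * x⁻¹) g := by
  obtain ⟨x, l, hne, hl, hx⟩ := (exists_conj_cyclicallyReduced φ g).resolve_left hg
  suffices H : ∃ y, ∀ m : ℕ, 0 < m → ¬ Commute (y * letters φ l ^ m * y⁻¹) (letters φ l) by
    obtain ⟨y, hy⟩ := H
    refine ⟨x⁻¹ * y * x, fun m hm hc => hy m hm ?_⟩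
    rw [← Commute.conj_iff x, hx] at hc
    rw [← hx, conj_pow]
    convert hc using 1
    group
  have hw := fun m hm => IsRed.pow (φ := φ) (m := m) hl hne hm
  have hw1 := hw 1 one_pos
  rw [pow_one] at hw1
  generalize (l.head hne).1 = e at hw hw1
  generalize (l.getLast hne).1 = f at hw hw1
  by_cases hef : f = e
  · subst hef
    refine ⟨of a, fun m hm hc => ?_⟩
    have := ((hw1.mul_of a).mul ((hw m hm).mul_of a⁻¹)).unique (((hw m hm).mul_of a⁻¹).mul hw1)
      (a := 1) (b := a) (by
        have := hc.eq
        simp only [map_one, map_inv, one_mul, mul_assoc] at this ⊢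
        exact this.symm)
    exact notMem_toSubgroup hA hB _ (by simpa using this.2)
  · have hf : f = -e := by
      rcases Int.units_eq_one_or e with rfl | rfl <;>
        rcases Int.units_eq_one_or f with rfl | rfl <;> simp_all
    subst hf
    have hA' : a⁻¹ ∉ A := by simpa
    have hB' : a⁻¹ ∉ B := by simpa
    have hp := isRed_t_of_t (φ := φ) (-e) e (notMem_toSubgroup hA hB _)
    have hq := isRed_t_of_t (φ := φ) (-e) e (notMem_toSubgroup hA' hB' _)
    refine ⟨t ^ ((-e : ℤˣ) : ℤ) * of a * t ^ (e : ℤ), fun m hm hc => ?_⟩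
    have := (hw1.mul ((hp.mul (hw m hm)).mul hq)).unique (((hp.mul (hw m hm)).mul hq).mul hw1)
      (a := 1) (b := 1) (by
        have h := hc.eq
        simp only [map_one, map_inv, one_mul, _root_.mul_inv_rev, Units.val_neg,
          _root_.zpow_neg, inv_inv, mul_assoc] at h ⊢
        exact h.symm)
    have := this.1
    rcases Int.units_eq_one_or e with rfl | rfl <;> simp at this

variable (φ) in
theorem exists_conj_pow_mem [A.FiniteIndex] [B.FiniteIndex] (x : HNNExtension G A B φ) (h : G) :
    ∃ m : ℕ, 0 < m ∧ ∃ k, x * of h ^ m * x⁻¹ = of k := by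
  suffices H : (∀ h : G, ∃ m : ℕ, 0 < m ∧ ∃ k, x * of h ^ m * x⁻¹ = of k) ∧
      ∀ h : G, ∃ m : ℕ, 0 < m ∧ ∃ k, x⁻¹ * of h ^ m * x⁻¹⁻¹ = of k from H.1 h
  induction x using HNNExtension.induction_on with
  | of g =>
    exact ⟨fun h => ⟨1, one_pos, g * h * g⁻¹, by simp only [map_mul, map_inv, pow_one]⟩,
      fun h => ⟨1, one_pos, g⁻¹ * h * g, by simp only [map_mul, map_inv, pow_one, inv_inv]⟩⟩
  | t =>
    constructor
    · intro h
      obtain ⟨m, hm, -, hmem⟩ := Subgroup.exists_pow_mem_of_index_ne_zero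
        (Subgroup.FiniteIndex.index_ne_zero (H := A)) h
      exact ⟨m, hm, φ ⟨h ^ m, hmem⟩, by rw [equiv_eq_conj]; simp⟩
    · intro h
      obtain ⟨m, hm, -, hmem⟩ := Subgroup.exists_pow_mem_of_index_ne_zero
        (Subgroup.FiniteIndex.index_ne_zero (H := B)) h
      exact ⟨m, hm, φ.symm ⟨h ^ m, hmem⟩, by rw [equiv_symm_eq_conj]; simp⟩
  | mul x y hx hy =>
    have aux : ∀ x y : HNNExtension G A B φ,
        (∀ h : G, ∃ m : ℕ, 0 < m ∧ ∃ k, x * of h ^ m * x⁻¹ = of k) →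
        (∀ h : G, ∃ m : ℕ, 0 < m ∧ ∃ k, y * of h ^ m * y⁻¹ = of k) →
        ∀ h : G, ∃ m : ℕ, 0 < m ∧ ∃ k, x * y * of h ^ m * (x * y)⁻¹ = of k := by
      intro x y hx hy h
      obtain ⟨m, hm, k, hk⟩ := hy h
      obtain ⟨m', hm', k', hk'⟩ := hx k
      refine ⟨m * m', Nat.mul_pos hm hm', k', ?_⟩
      rw [← hk', ← hk, conj_pow, pow_mul]
      group
    exact ⟨aux x y hx.1 hy.1, by rw [_root_.mul_inv_rev]; exact aux y⁻¹ x⁻¹ hy.2 hx.2⟩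
  | inv x hx => exact ⟨hx.2, by rw [inv_inv]; exact hx.1⟩

end Elliptic

section Modular

variable {G : Type*} [CommGroup G] {A B : Subgroup G} (φ : A ≃* B)

/-- The exponent sum of the stable letter. -/
def expo : HNNExtension G A B φ →* Multiplicative ℤ :=
  lift 1 (ofAdd 1) (by simp)

@[simp]
theorem expo_of (g : G) : expo φ (of g) = 1 := by simp [expo]

@[simp]
theorem expo_t : expo φ t = ofAdd 1 := by simp [expo]

theorem expo_letters (l : List (ℤˣ × G)) :
    expo φ (letters φ l) = ofAdd (l.map fun p => (p.1 : ℤ)).sum := by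
  induction l with
  | nil => simp
  | cons p l ih => simp [ih, ofAdd_add, ← ofAdd_zsmul]

variable {V : Type*} [CommGroup V] (ι : G →* V) (α : MulAut V)

/-- If the base group embeds in `V` so that `φ` is the restriction of `α`, then conjugation by `g`
acts on the base group as `α ^ expo g`. -/
theorem conj_eq_expo (hα : ∀ a : A, ι (φ a) = α (ι a)) {g : HNNExtension G A B φ} {x y : G}
    (h : g * of y = of x * g) : ι x = (α ^ toAdd (expo φ g)) (ι y) := by
  let ρ : HNNExtension G A B φ →* V ⋊[zpowersHom (MulAut V) α] Multiplicative ℤ :=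
    lift (SemidirectProduct.inl.comp ι) (SemidirectProduct.inr (ofAdd 1)) (by
      intro a
      ext <;> simp [hα])
  have hρ : SemidirectProduct.rightHom.comp ρ = expo φ := by
    ext <;> simp [ρ]
  have h1 := congrArg SemidirectProduct.left (congrArg ρ h)
  have h2 : (ρ g).right = expo φ g := DFunLike.congr_fun hρ g
  have h3 : ∀ x, ρ (of x) = SemidirectProduct.inl (ι x) := by simp [ρ]
  simp only [map_mul, SemidirectProduct.mul_left, h3, SemidirectProduct.left_inl,
    SemidirectProduct.right_inl, map_one, MulAut.one_apply, h2, zpowersHom_apply] at h1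
  rw [mul_comm] at h1
  exact (mul_right_cancel h1).symm

/-- If a base group element `x` fixes a path in the Bass–Serre tree starting at height `k ≥ 0` and
ending at negative height, then translating back to height zero gives an element of `A`. -/
theorem exists_mem_of_crossing (hα : ∀ a : A, ι (φ a) = α (ι a)) (l : List (ℤˣ × G))
    (hl : Reduced A B l) (k : ℤ) (hk : 0 ≤ k) (hs : k + (l.map fun p => (p.1 : ℤ)).sum < 0)
    (x y : G) (h : letters φ l * of y = of x * letters φ l) : ∃ a ∈ A, ι a = (α ^ k) (ι x) := by
  induction l generalizing k x with
  | nil => simp at hs; omega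
  | cons p l ih =>
    obtain ⟨u, g⟩ := p
    have hr := letters_isRed φ hl (by simp)
    have hx := ((hr.mul_of y).unique hr (a := 1) (b := x) (by rw [map_one, one_mul, h])).2
    simp only [List.head_cons, inv_one, one_mul] at hx
    have hl' : Reduced A B l := List.IsChain.tail hl
    have hcomm := t_zpow_mul_of φ hx
    generalize hz : (toSubgroupEquiv φ (-u) ⟨x, hx⟩ : G) = z at hcomm
    have h' : letters φ l * of y = of z * letters φ l := by
      rw [letters_cons] at h
      have e : (t ^ (u : ℤ) * of z : HNNExtension G A B φ) = of x * t ^ (u : ℤ) := by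
        rw [Units.val_neg, _root_.zpow_neg] at hcomm
        rw [inv_mul_eq_iff_eq_mul] at hcomm
        rw [hcomm]; group
      have hgz : (of g * of z : HNNExtension G A B φ) = of z * of g := by
        rw [← map_mul, mul_comm, map_mul]
      apply mul_left_cancel (a := t ^ (u : ℤ) * of g)
      calc _ = (of x * t ^ (u : ℤ)) * (of g * letters φ l) := by
              rw [← mul_assoc, h]; simp only [mul_assoc]
        _ = t ^ (u : ℤ) * (of z * of g) * letters φ l := by rw [← e]; simp only [mul_assoc]
        _ = _ := by rw [← hgz]; simp only [mul_assoc]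
    rcases Int.units_eq_one_or u with rfl | rfl
    · obtain ⟨a, ha, hax⟩ := ih hl' (k + 1) (by omega) (by simpa [add_assoc] using hs) z h'
      refine ⟨a, ha, ?_⟩
      have hzA : z ∈ A := by rw [← hz]; exact (φ.symm ⟨x, hx⟩).2
      have hzx : (φ ⟨z, hzA⟩ : G) = x := by
        have : (⟨z, hzA⟩ : A) = φ.symm ⟨x, hx⟩ := Subtype.ext hz.symm
        rw [this, φ.apply_symm_apply]
      rw [hax, ← hzx, hα, _root_.zpow_add, zpow_one, MulAut.mul_apply]
    · have hxA : x ∈ A := hx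
      rcases hk.eq_or_lt with rfl | hk
      · exact ⟨x, hxA, by simp⟩
      obtain ⟨a, ha, hax⟩ := ih hl' (k - 1) (by omega)
        (by simpa [sub_eq_add_neg, add_assoc] using hs) z h'
      refine ⟨a, ha, ?_⟩
      have hzx : (φ ⟨x, hxA⟩ : G) = z := hz
      rw [hax, ← hzx, hα, _root_.zpow_sub_one, MulAut.mul_apply, MulAut.inv_apply_self]

theorem mem_of_expo_eq_neg_one (hι : Function.Injective ι) (hα : ∀ a : A, ι (φ a) = α (ι a))
    {g : HNNExtension G A B φ} (hg : expo φ g = ofAdd (-1)) {x y : G} (h : g * of y = of x * g) :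
    x ∈ A := by
  obtain ⟨c, l, hl, rfl⟩ := exists_reduced φ g
  have hs : (l.map fun p => (p.1 : ℤ)).sum = -1 := by
    rw [map_mul, expo_of, one_mul, expo_letters] at hg
    exact ofAdd.injective hg
  obtain ⟨a, ha, hax⟩ := exists_mem_of_crossing φ ι α hα l hl 0 le_rfl (by omega) x y (by
    apply mul_left_cancel (a := of c)
    rw [← mul_assoc, h, ← mul_assoc, ← mul_assoc, ← map_mul, ← map_mul, mul_comm])
  rw [zpow_zero, MulAut.one_apply] at hax
  rwa [← hι hax]

end Modular

section Isomorphism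

variable {G G' : Type*} [CommGroup G] [CommGroup G'] {A B : Subgroup G} {A' B' : Subgroup G'}
  {φ : A ≃* B} {φ' : A' ≃* B'}

theorem exists_notMem_notMem (hA : A ≠ ⊤) (hB : B ≠ ⊤) : ∃ a, a ∉ A ∧ a ∉ B := by
  obtain ⟨x, -, hx⟩ := SetLike.exists_of_lt hA.lt_top
  obtain ⟨y, -, hy⟩ := SetLike.exists_of_lt hB.lt_top
  by_cases hxB : x ∈ B
  · by_cases hyA : y ∈ A
    · exact ⟨x * y, by rwa [mul_mem_cancel_right hyA], by rwa [mul_mem_cancel_left hxB]⟩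
    · exact ⟨y, hyA, hy⟩
  · exact ⟨x, hx, hxB⟩

/-- The image of the base group under an isomorphism contains a conjugate of the base group. -/
theorem exists_conj_symm_mem [A.FiniteIndex] [B.FiniteIndex] (hA : A ≠ ⊤) (hB : B ≠ ⊤)
    (hA' : A' ≠ ⊤) (hB' : B' ≠ ⊤) (Φ : HNNExtension G A B φ ≃* HNNExtension G' A' B' φ') :
    ∃ c, ∀ k : G', ∃ h : G, Φ.symm (c * of k * c⁻¹) = of h := by
  obtain ⟨a, haA, haB⟩ := exists_notMem_notMem hA hB
  obtain ⟨a', haA', haB'⟩ := exists_notMem_notMem hA' hB'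
  have hell : ∃ x k, x * Φ (of a) * x⁻¹ = of k := by
    by_contra hcon
    obtain ⟨x, hx⟩ := exists_not_commute haA' haB' hcon
    obtain ⟨m, hm, k, hk⟩ := exists_conj_pow_mem φ (Φ.symm x) a
    refine hx m hm ?_
    have : Commute (of k : HNNExtension G A B φ) (of a) := (Commute.all k a).map of
    rw [← hk] at this
    simpa using this.map Φ
  obtain ⟨x, k, hk⟩ := hell
  refine ⟨x⁻¹, fun k' => mem_range_of_conj (b := a) haA haB ?_⟩
  apply Φ.injective
  have hc : (of k' * of k : HNNExtension G' A' B' φ') = of k * of k' := by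
    rw [← map_mul, mul_comm, map_mul]
  have hk' : Φ (of a) = x⁻¹ * of k * x := by rw [← hk]; group
  simp only [map_mul, map_inv, MulEquiv.apply_symm_apply, hk']
  calc _ = x⁻¹ * (of k' * of k) * (of k')⁻¹ * x := by group
    _ = _ := by rw [hc]; group

/-- After a conjugation, an isomorphism carries the base group onto the base group. -/
theorem exists_mulEquiv_base [A.FiniteIndex] [B.FiniteIndex] [A'.FiniteIndex] [B'.FiniteIndex]
    (hA : A ≠ ⊤) (hB : B ≠ ⊤) (hA' : A' ≠ ⊤) (hB' : B' ≠ ⊤)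
    (Φ : HNNExtension G A B φ ≃* HNNExtension G' A' B' φ') :
    ∃ (Ψ : HNNExtension G A B φ ≃* HNNExtension G' A' B' φ') (β : G ≃* G'),
      ∀ h, Ψ (of h) = of (β h) := by
  obtain ⟨c, hc⟩ := exists_conj_symm_mem hA hB hA' hB' Φ
  let Ψ := Φ.trans (MulAut.conj c⁻¹)
  have hΨ : ∀ k : G', ∃ h : G, Ψ.symm (of k) = of h := by
    intro k
    obtain ⟨h, hh⟩ := hc k
    refine ⟨h, ?_⟩
    rw [← hh, MulEquiv.symm_apply_eq]
    simp only [Ψ, MulEquiv.trans_apply, MulEquiv.apply_symm_apply, MulAut.conj_apply]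
    group
  obtain ⟨d, hd⟩ := exists_conj_symm_mem hA' hB' hA hB Ψ.symm
  obtain ⟨a, haA, haB⟩ := exists_notMem_notMem hA hB
  have hd' : ∀ h : G, ∃ h', d * of h * d⁻¹ = of h' := by
    intro h
    obtain ⟨k, hk⟩ := hd h
    obtain ⟨h', hh'⟩ := hΨ k
    exact ⟨h', by rw [← hh', ← hk]; simp⟩
  obtain ⟨a', ha'⟩ := hd' a
  obtain ⟨e, rfl⟩ := mem_range_of_conj haA haB ha'
  have hΨ' : ∀ h : G, ∃ k, Ψ (of h) = of k := by
    intro h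
    obtain ⟨k, hk⟩ := hd h
    refine ⟨k, ?_⟩
    rw [← hk, MulEquiv.symm_symm, ← map_inv, ← map_mul, ← map_mul, mul_comm e h,
      mul_inv_cancel_right]
  choose f hf using hΨ'
  choose g hg using hΨ
  have hfg : ∀ k, f (g k) = k := fun k => of_injective (φ := φ') (by rw [← hf, ← hg]; simp)
  have hgf : ∀ h, g (f h) = h := fun h => of_injective (φ := φ) (by rw [← hg, ← hf]; simp)
  exact ⟨Ψ, MulEquiv.mk ⟨f, g, hgf, hfg⟩ fun x y =>
    of_injective (φ := φ') (by simp [← hf]), hf⟩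

/-- Isomorphic non-ascending HNN extensions of abelian groups along finite-index subgroups have the
same defining data, up to replacing the stable letter by its inverse. -/
theorem data_of_mulEquiv [A.FiniteIndex] [B.FiniteIndex] [A'.FiniteIndex] [B'.FiniteIndex]
    (hA : A ≠ ⊤) (hB : B ≠ ⊤) (hA' : A' ≠ ⊤) (hB' : B' ≠ ⊤)
    {V V' : Type*} [CommGroup V] [CommGroup V'] (ι : G →* V) (α : MulAut V) (ι' : G' →* V')
    (α' : MulAut V') (hι : Function.Injective ι) (hι' : Function.Injective ι')
    (hα : ∀ a : A, ι (φ a) = α (ι a)) (hα' : ∀ a : A', ι' (φ' a) = α' (ι' a))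
    (Φ : HNNExtension G A B φ ≃* HNNExtension G' A' B' φ') :
    ∃ β : G ≃* G',
      ((∀ a : A, ι' (β (φ a)) = α' (ι' (β a))) ∧ A' = A.map β.toMonoidHom) ∨
      ((∀ a : A, ι' (β (φ a)) = α'⁻¹ (ι' (β a))) ∧ A' = B.map β.toMonoidHom) := by
  obtain ⟨Ψ, β, hβ⟩ := exists_mulEquiv_base hA hB hA' hB' Φ
  have hβ' : ∀ k, Ψ.symm (of k) = of (β.symm k) := fun k => by
    rw [MulEquiv.symm_apply_eq, hβ, MulEquiv.apply_symm_apply]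
  obtain ⟨n, hn⟩ : ∃ n : ℤ, expo φ' (Ψ t) = ofAdd n := ⟨toAdd (expo φ' (Ψ t)), rfl⟩
  have hexp : ∀ g, toAdd (expo φ' (Ψ g)) = n * toAdd (expo φ g) := by
    have : (expo φ').comp Ψ.toMonoidHom = (zpowGroupHom n).comp (expo φ) := by
      apply hom_ext
      · ext g
        simp [hβ]
      · simp [hn, ← ofAdd_zsmul]
    intro g
    have := DFunLike.congr_fun this g
    simpa using congrArg toAdd this
  have hunit : n * toAdd (expo φ (Ψ.symm t)) = 1 := by
    rw [← hexp]; simp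
  have ht : ∀ a : A, Ψ t * of (β a) = of (β (φ a)) * Ψ t := fun a => by
    rw [← hβ, ← hβ, ← map_mul, ← map_mul, t_mul_of]
  have hmod : ∀ a : A, ι' (β (φ a)) = (α' ^ n) (ι' (β a)) := fun a => by
    have := conj_eq_expo φ' ι' α' hα' (ht a)
    rwa [hn] at this
  have hs : ∀ a : A', Ψ.symm t⁻¹ * of (β.symm (φ' a)) = of (β.symm a) * Ψ.symm t⁻¹ := fun a => by
    rw [← hβ', ← hβ', ← map_mul, ← map_mul]
    congr 1
    rw [inv_t_mul_of, MulEquiv.symm_apply_apply]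
  rcases Int.eq_one_or_neg_one_of_mul_eq_one hunit with rfl | rfl
  · refine ⟨β, Or.inl ⟨by simpa using hmod, ?_⟩⟩
    ext k
    constructor
    · intro hk
      refine ⟨β.symm k, mem_of_expo_eq_neg_one φ ι α hι hα ?_ (hs ⟨k, hk⟩), by simp⟩
      rw [map_inv, map_inv, ofAdd_neg]
      congr 1
      exact toAdd.injective (by simpa using hunit)
    · rintro ⟨a, ha, rfl⟩
      refine mem_of_expo_eq_neg_one φ' ι' α' hι' hα' (g := Ψ t⁻¹) (y := β (φ ⟨a, ha⟩)) ?_ ?_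
      · rw [map_inv, map_inv, hn, ofAdd_neg]
      · have := ht ⟨a, ha⟩
        rw [map_inv, inv_mul_eq_iff_eq_mul, ← mul_assoc]
        exact eq_mul_inv_of_mul_eq this.symm
  · refine ⟨β, Or.inr ⟨by simpa using hmod, ?_⟩⟩
    ext k
    constructor
    · intro hk
      have e := hs ⟨k, hk⟩
      have hexp' : expo φ (Ψ.symm t⁻¹) = ofAdd 1 := by
        have : toAdd (expo φ (Ψ.symm t)) = -1 := by omega
        rw [map_inv, map_inv, ← ofAdd_toAdd (expo φ (Ψ.symm t)), this]; rfl
      have hmem : β.symm (φ' ⟨k, hk⟩) ∈ A := by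
        refine mem_of_expo_eq_neg_one φ ι α hι hα (g := (Ψ.symm t⁻¹)⁻¹) (y := β.symm k) ?_ ?_
        · rw [map_inv, hexp']; rfl
        · rw [inv_mul_eq_iff_eq_mul, ← mul_assoc]
          exact eq_mul_inv_of_mul_eq e.symm
      have hk' := conj_eq_expo φ ι α hα e
      rw [hexp', toAdd_ofAdd, zpow_one, ← hα ⟨_, hmem⟩] at hk'
      refine ⟨β.symm k, ?_, by simp⟩
      change β.symm k ∈ B
      have h2 := hι hk'
      simp only at h2
      rw [h2]
      exact (φ _).2
    · rintro ⟨b, hb, rfl⟩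
      have := ht (φ.symm ⟨b, hb⟩)
      rw [MulEquiv.apply_symm_apply] at this
      exact mem_of_expo_eq_neg_one φ' ι' α' hι' hα' hn this

end Isomorphism

end HNNExtension

theorem ZtoQ_apply {n : ℕ} (v : Fin n → ℤ) (i : Fin n) : ZtoQ n v i = (v i : ℚ) := rfl

theorem ZtoQ_injective (n : ℕ) : Function.Injective (ZtoQ n) := fun v w h => by
  funext i
  simpa [ZtoQ_apply] using congrFun h i

theorem ALsub_mem {n : ℕ} {A : Matrix (Fin n) (Fin n) ℚ} {L : AddSubgroup (Fin n → ℤ)}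
    {w : Fin n → ℤ} : w ∈ ALsub A L ↔ ∃ v ∈ L, A.mulVec (ZtoQ n v) = ZtoQ n w := by
  simp [ALsub, QImage, AddSubgroup.mem_map]

theorem QMat_mulVec_ZtoQ {n : ℕ} (B : Matrix (Fin n) (Fin n) ℤ) (v : Fin n → ℤ) :
    (QMat B).mulVec (ZtoQ n v) = ZtoQ n (B.mulVec v) := by
  funext i
  simp [QMat, Matrix.mulVec, dotProduct, ZtoQ_apply]

/-- The isomorphism `L → AL`, `v ↦ Av`. -/
theorem exists_addEquiv_ALsub {n : ℕ} {A : Matrix (Fin n) (Fin n) ℚ} (hA : IsUnit A.det)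
    {L : AddSubgroup (Fin n → ℤ)} (hLA : QImage A L ≤ (ZtoQ n).range) :
    ∃ θ : L ≃+ ALsub A L, ∀ v : L, ZtoQ n (θ v) = A.mulVec (ZtoQ n v) := by
  have hex : ∀ v : L, ∃ w : ALsub A L, ZtoQ n w = A.mulVec (ZtoQ n v) := by
    intro v
    obtain ⟨w, hw⟩ := hLA (show A.mulVec (ZtoQ n v) ∈ QImage A L from
      ⟨ZtoQ n v, ⟨v, v.2, rfl⟩, rfl⟩)
    exact ⟨⟨w, ALsub_mem.2 ⟨v, v.2, hw.symm⟩⟩, hw⟩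
  choose f hf using hex
  have hinj : Function.Injective A.mulVec :=
    Matrix.mulVec_injective_iff_isUnit.2 ((Matrix.isUnit_iff_isUnit_det A).2 hA)
  refine ⟨AddEquiv.ofBijective (AddMonoidHom.mk' f fun v w => ?_) ⟨fun v w h => ?_, fun w => ?_⟩,
    hf⟩
  · apply Subtype.ext
    apply ZtoQ_injective
    simp [hf, Matrix.mulVec_add]
  · apply Subtype.ext
    apply ZtoQ_injective
    apply hinj
    rw [← hf, ← hf]
    exact congrArg (fun w : ALsub A L => ZtoQ n w) h
  · obtain ⟨v, hv, hvw⟩ := ALsub_mem.1 w.2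
    refine ⟨⟨v, hv⟩, ?_⟩
    apply Subtype.ext
    apply ZtoQ_injective
    rw [← hvw]
    exact hf ⟨v, hv⟩

theorem finiteIndex_of_addEquiv {n : ℕ} {L L' : AddSubgroup (Fin n → ℤ)} (hL : L.FiniteIndex)
    (θ : L ≃+ L') : L'.FiniteIndex := by
  have h1 : Finite ((Fin n → ℤ) ⧸ AddSubgroup.toIntSubmodule L) :=
    AddSubgroup.finite_quotient_of_finiteIndex (H := L)
  rw [Submodule.finiteQuotient_iff] at h1
  have h2 : Finite ((Fin n → ℤ) ⧸ AddSubgroup.toIntSubmodule L') := by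
    rw [Submodule.finiteQuotient_iff, ← h1]
    exact (LinearEquiv.finrank_eq θ.toIntLinearEquiv).symm
  have h3 : Finite ((Fin n → ℤ) ⧸ L') := h2
  exact AddSubgroup.finiteIndex_of_finite_quotient (H := L')

/-- For pairwise commuting `f i`, the homomorphism `v ↦ f 1 ^ v 1 ⋯ f n ^ v n`. -/
def prodZPowHom {M : Type*} [Group M] {n : ℕ} (f : Fin n → M) (hf : ∀ i j, Commute (f i) (f j)) :
    Multiplicative (Fin n → ℤ) →* M :=
  MonoidHom.mk' (fun v => (List.ofFn fun i => f i ^ (v.toAdd i)).prod) (by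
    intro v w
    simp only [toAdd_mul, Pi.add_apply]
    generalize v.toAdd = v
    generalize w.toAdd = w
    induction n with
    | zero => simp
    | succ n ih =>
      simp only [List.ofFn_succ, List.prod_cons]
      rw [ih (fun i => f i.succ) (fun i j => hf _ _) (fun i => v i.succ) (fun i => w i.succ)]
      have hc : Commute (f 0 ^ w 0) (List.ofFn fun i : Fin n => f i.succ ^ v i.succ).prod := by
        apply Commute.list_prod_right
        intro x hx
        obtain ⟨i, rfl⟩ := List.mem_ofFn.1 hx
        exact (hf _ _).zpow_zpow _ _
      rw [_root_.zpow_add]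
      simp only [mul_assoc]
      rw [hc.left_comm])

theorem prod_ofFn_zpow_single {M : Type*} [Group M] {n : ℕ} (f : Fin n → M) (i : Fin n) :
    (List.ofFn fun j => f j ^ (Pi.single i 1 : Fin n → ℤ) j).prod = f i := by
  induction n with
  | zero => exact i.elim0
  | succ n ih =>
    rw [List.ofFn_succ, List.prod_cons]
    cases i using Fin.cases with
    | zero =>
      rw [List.prod_eq_one fun x hx => ?_]
      · simp
      · obtain ⟨j, rfl⟩ := List.mem_ofFn.1 hx
        simp [Fin.succ_ne_zero]
    | succ i =>
      have h := ih (fun j => f j.succ) i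
      simp only [Pi.single_apply, Fin.succ_inj] at h ⊢
      rw [h]
      simp [(Fin.succ_ne_zero i).symm]

theorem map_prod_single {M : Type*} [Group M] {n : ℕ} (f : Multiplicative (Fin n → ℤ) →* M)
    (v : Fin n → ℤ) :
    (List.ofFn fun i => f (Multiplicative.ofAdd (Pi.single i 1)) ^ v i).prod =
      f (Multiplicative.ofAdd v) := by
  have : (List.ofFn fun i => f (Multiplicative.ofAdd (Pi.single i 1)) ^ v i) =
      (List.ofFn fun i => Multiplicative.ofAdd (Pi.single i (1 : ℤ) : Fin n → ℤ) ^ v i).map f := by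
    simp [List.map_ofFn, Function.comp_def]
  rw [this, ← map_list_prod, List.prod_ofFn]
  congr 1
  apply Multiplicative.toAdd.injective
  simp only [toAdd_prod, toAdd_zpow, toAdd_ofAdd]
  funext j
  simp [Finset.sum_apply, Pi.single_apply]

/-- The isomorphism of multiplicative subgroups underlying an isomorphism of additive subgroups. -/
def toSubgroupMulEquiv {M : Type*} [AddGroup M] {L L' : AddSubgroup M} (θ : L ≃+ L') :
    AddSubgroup.toSubgroup L ≃* AddSubgroup.toSubgroup L' where
  toFun a := ⟨Multiplicative.ofAdd (θ ⟨a.1.toAdd, a.2⟩ : M), (θ ⟨a.1.toAdd, a.2⟩).2⟩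
  invFun a := ⟨Multiplicative.ofAdd (θ.symm ⟨a.1.toAdd, a.2⟩ : M), (θ.symm ⟨a.1.toAdd, a.2⟩).2⟩
  left_inv a := by simp
  right_inv a := by simp
  map_mul' a b := by
    apply Subtype.ext
    exact congrArg (fun w : L' => Multiplicative.ofAdd (w : M))
      (map_add θ ⟨a.1.toAdd, a.2⟩ ⟨b.1.toAdd, b.2⟩)

theorem lift_xWord {M : Type*} [Group M] {n : ℕ} (f : Fin n ⊕ Unit → M) (v : Fin n → ℤ) :
    FreeGroup.lift f (xWord n v) = (List.ofFn fun i => f (Sum.inl i) ^ v i).prod := by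
  simp [xWord, map_list_prod, List.map_ofFn, Function.comp_def]

theorem mk_xWord {n : ℕ} (A : Matrix (Fin n) (Fin n) ℚ) (L : AddSubgroup (Fin n → ℤ))
    (v : Fin n → ℤ) : PresentedGroup.mk (LMrels n A L) (xWord n v) = Xv n A L v := by
  simp [xWord, Xv, Xg, PresentedGroup.of, map_list_prod, List.map_ofFn, Function.comp_def]

theorem Xg_commute {n : ℕ} (A : Matrix (Fin n) (Fin n) ℚ) (L : AddSubgroup (Fin n → ℤ))
    (i j : Fin n) : Commute (Xg n A L i) (Xg n A L j) := by
  have := PresentedGroup.one_of_mem (rels := LMrels n A L) (Or.inl ⟨i, j, rfl⟩)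
  simp only [map_mul, map_inv] at this
  rw [mul_inv_eq_one, mul_inv_eq_iff_eq_mul] at this
  exact this

/-- `G(A, L)` is the HNN extension of `ℤ^n` along `L → AL`. -/
theorem nonempty_LM_mulEquiv {n : ℕ} {A : Matrix (Fin n) (Fin n) ℚ}
    {L : AddSubgroup (Fin n → ℤ)} (θ : L ≃+ ALsub A L)
    (hθ : ∀ v : L, ZtoQ n (θ v) = A.mulVec (ZtoQ n v)) :
    Nonempty (LM n A L ≃* HNNExtension (Multiplicative (Fin n → ℤ)) (AddSubgroup.toSubgroup L)
      (AddSubgroup.toSubgroup (ALsub A L)) (toSubgroupMulEquiv θ)) := by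
  let f : Fin n ⊕ Unit → HNNExtension (Multiplicative (Fin n → ℤ)) (AddSubgroup.toSubgroup L)
      (AddSubgroup.toSubgroup (ALsub A L)) (toSubgroupMulEquiv θ) :=
    Sum.elim (fun i => HNNExtension.of (Multiplicative.ofAdd (Pi.single i 1)))
      (fun _ => HNNExtension.t)
  have hf : ∀ v, FreeGroup.lift f (xWord n v) = HNNExtension.of (Multiplicative.ofAdd v) :=
    fun v => by rw [lift_xWord]; exact map_prod_single _ v
  have hrel : ∀ r ∈ LMrels n A L, FreeGroup.lift f r = 1 := by
    rintro r (⟨i, j, rfl⟩ | ⟨v, hv, w, hw, rfl⟩)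
    · simp only [map_mul, map_inv, FreeGroup.lift_apply_of, f, Sum.elim_inl]
      rw [← map_mul, mul_comm, map_mul, mul_inv_cancel_right, mul_inv_cancel]
    · simp only [map_mul, map_inv, hf]
      rw [mul_inv_eq_one, FreeGroup.lift_apply_of]
      have hwv : w = θ ⟨v, hv⟩ := ZtoQ_injective n (by rw [hw, hθ])
      subst hwv
      exact (HNNExtension.equiv_eq_conj (φ := toSubgroupMulEquiv θ)
        ⟨Multiplicative.ofAdd v, hv⟩).symm
  let F := PresentedGroup.toGroup hrel
  let X := prodZPowHom (Xg n A L) (Xg_commute A L)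
  have hX : ∀ v, X v = Xv n A L v.toAdd := fun v => rfl
  let K : HNNExtension (Multiplicative (Fin n → ℤ)) (AddSubgroup.toSubgroup L)
      (AddSubgroup.toSubgroup (ALsub A L)) (toSubgroupMulEquiv θ) →* LM n A L :=
    HNNExtension.lift X (Tg n A L) (by
      rintro ⟨a, ha⟩
      have := PresentedGroup.one_of_mem (rels := LMrels n A L)
        (Or.inr ⟨a.toAdd, ha, θ ⟨a.toAdd, ha⟩, hθ _, rfl⟩)
      simp only [map_mul, map_inv, mk_xWord] at this
      rw [mul_inv_eq_one, mul_inv_eq_iff_eq_mul] at this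
      exact this)
  have hFX : ∀ v, F (X v) = HNNExtension.of v := fun v => by
    rw [hX, ← mk_xWord]
    exact hf _
  have hFof : ∀ x, F (PresentedGroup.of x) = f x := fun x => PresentedGroup.toGroup.of hrel
  have hKof : ∀ v, K (HNNExtension.of v) = X v := HNNExtension.lift_of _ _ _
  have hKt : K HNNExtension.t = Tg n A L := HNNExtension.lift_t _ _ _
  refine ⟨MonoidHom.toMulEquiv F K ?_ ?_⟩
  · apply PresentedGroup.ext
    rintro (i | ⟨⟩)
    · rw [MonoidHom.comp_apply, hFof]
      exact (hKof _).trans (prod_ofFn_zpow_single (Xg n A L) i)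
    · rw [MonoidHom.comp_apply, hFof]
      exact hKt
  · apply HNNExtension.hom_ext
    · refine MonoidHom.ext fun v => ?_
      exact (congrArg F (hKof v)).trans (hFX v)
    · exact (congrArg F hKt).trans (hFof (Sum.inr ()))

theorem matrix_eq_of_finiteIndex {n : ℕ} {L : AddSubgroup (Fin n → ℤ)} (hL : L.FiniteIndex)
    {M N : Matrix (Fin n) (Fin n) ℚ}
    (h : ∀ v ∈ L, M.mulVec (ZtoQ n v) = N.mulVec (ZtoQ n v)) : M = N := by
  apply Matrix.ext_of_mulVec_single
  intro j
  obtain ⟨m, hm, -, hmem⟩ := AddSubgroup.exists_nsmul_mem_of_index_ne_zero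
    hL.index_ne_zero (Pi.single j 1 : Fin n → ℤ)
  have e : ZtoQ n (m • Pi.single j 1) = (m : ℚ) • Pi.single j 1 := by
    funext i
    by_cases hij : i = j
    · subst hij; simp [ZtoQ_apply]
    · simp [ZtoQ_apply, hij]
  have := h _ hmem
  rw [e, Matrix.mulVec_smul, Matrix.mulVec_smul] at this
  exact smul_right_injective _ (by positivity : (m : ℚ) ≠ 0) this

/-- Multiplication by an invertible matrix as an automorphism of (multiplicative) `ℚ^n`. -/
def mulVecAut {n : ℕ} (A : Matrix (Fin n) (Fin n) ℚ) (hA : IsUnit A.det) :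
    MulAut (Multiplicative (Fin n → ℚ)) :=
  AddEquiv.toMultiplicative (Matrix.toLinearEquiv' A (A.invertibleOfIsUnitDet hA)).toAddEquiv

/-- **Proposition (non-metabelian case).** If `G(A,L) ≅ G(Ā,L̄)` with
`L ≠ ℤ^n ≠ AL` and `L̄ ≠ ℤ^n̄ ≠ ĀL̄`, then `n = n̄` and there is `B ∈ GL_n(ℤ)` with
either `Ā = BAB⁻¹, L̄ = BL` or `Ā = BA⁻¹B⁻¹, L̄ = B(AL)`. -/
theorem LM_nonmetabelian_isomorphism
    (n nb : ℕ) (A : Matrix (Fin n) (Fin n) ℚ) (Ab : Matrix (Fin nb) (Fin nb) ℚ)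
    (hA : IsUnit A.det) (hAb : IsUnit Ab.det)
    (L : AddSubgroup (Fin n → ℤ)) (Lb : AddSubgroup (Fin nb → ℤ))
    (hL : L.FiniteIndex) (hLb : Lb.FiniteIndex)
    (hLA : QImage A L ≤ (ZtoQ n).range) (hLAb : QImage Ab Lb ≤ (ZtoQ nb).range)
    (hiso : Nonempty (LM n A L ≃* LM nb Ab Lb))
    (hneL : L ≠ ⊤) (hneAL : ALsub A L ≠ ⊤)
    (hneLb : Lb ≠ ⊤) (hneALb : ALsub Ab Lb ≠ ⊤) :
    ∃ h : nb = n, ∃ B : Matrix (Fin n) (Fin n) ℤ, IsUnit B.det ∧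
      ((Matrix.reindex (finCongr h) (finCongr h) Ab = QMat B * A * (QMat B)⁻¹ ∧
          reindexSub h Lb = L.map B.mulVecLin.toAddMonoidHom) ∨
       (Matrix.reindex (finCongr h) (finCongr h) Ab = QMat B * A⁻¹ * (QMat B)⁻¹ ∧
          reindexSub h Lb = (ALsub A L).map B.mulVecLin.toAddMonoidHom)) := by
  obtain ⟨θ, hθ⟩ := exists_addEquiv_ALsub hA hLA
  obtain ⟨θb, hθb⟩ := exists_addEquiv_ALsub hAb hLAb
  have hAL := finiteIndex_of_addEquiv hL θ
  have hALb := finiteIndex_of_addEquiv hLb θb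
  obtain ⟨Φ⟩ := hiso
  obtain ⟨E⟩ := nonempty_LM_mulEquiv θ hθ
  obtain ⟨Eb⟩ := nonempty_LM_mulEquiv θb hθb
  have fi : ∀ {k : ℕ} {K : AddSubgroup (Fin k → ℤ)}, K.FiniteIndex →
      (AddSubgroup.toSubgroup K).FiniteIndex := fun h => ⟨h.index_ne_zero⟩
  have ne : ∀ {k : ℕ} {K : AddSubgroup (Fin k → ℤ)}, K ≠ ⊤ → AddSubgroup.toSubgroup K ≠ ⊤ :=
    fun h h' => h (AddSubgroup.toSubgroup.injective (h'.trans (map_top _).symm))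
  have := fi hL
  have := fi hLb
  have := fi hAL
  have := fi hALb
  obtain ⟨β, hβ⟩ := HNNExtension.data_of_mulEquiv
    (φ := toSubgroupMulEquiv θ) (φ' := toSubgroupMulEquiv θb) (ne hneL) (ne hneAL) (ne hneLb) (ne hneALb)
    (AddMonoidHom.toMultiplicative (ZtoQ n)) (mulVecAut A hA)
    (AddMonoidHom.toMultiplicative (ZtoQ nb)) (mulVecAut Ab hAb)
    (ZtoQ_injective n) (ZtoQ_injective nb) (fun a => hθ ⟨a.1.toAdd, a.2⟩)
    (fun a => hθb ⟨a.1.toAdd, a.2⟩) ((E.symm.trans Φ).trans Eb)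
  let b : (Fin n → ℤ) ≃ₗ[ℤ] (Fin nb → ℤ) := (AddEquiv.toMultiplicative.symm β).toIntLinearEquiv
  obtain rfl : nb = n := by simpa using b.finrank_eq.symm
  have hb : ∀ v, (LinearMap.toMatrix' b.toLinearMap).mulVec v = b v := fun v =>
    LinearMap.toMatrix'_mulVec _ v
  have hdet : IsUnit (LinearMap.toMatrix' b.toLinearMap).det := by
    rw [LinearMap.det_toMatrix']
    exact b.isUnit_det'
  generalize LinearMap.toMatrix' b.toLinearMap = B at hb hdet
  have hQdet : IsUnit (QMat B).det := by
    have : (QMat B).det = (Int.castRingHom ℚ) B.det := ((Int.castRingHom ℚ).map_det B).symm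
    rw [this]
    exact hdet.map _
  have hβB : ∀ v, ZtoQ nb (β (Multiplicative.ofAdd v)).toAdd = (QMat B).mulVec (ZtoQ nb v) :=
    fun v => by rw [QMat_mulVec_ZtoQ, hb]; rfl
  have himage : ∀ K : AddSubgroup (Fin nb → ℤ),
      AddSubgroup.toSubgroup Lb = (AddSubgroup.toSubgroup K).map β.toMonoidHom →
      reindexSub rfl Lb = K.map B.mulVecLin.toAddMonoidHom := by
    intro K hK
    have h1 : reindexSub rfl Lb = Lb := AddSubgroup.map_id Lb
    rw [h1]
    ext v
    have h2 := SetLike.ext_iff.1 hK (Multiplicative.ofAdd v)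
    refine h2.trans ⟨?_, ?_⟩
    · rintro ⟨w, hw, hwv⟩
      exact ⟨w.toAdd, hw, (hb _).trans hwv⟩
    · rintro ⟨w, hw, hwv⟩
      exact ⟨Multiplicative.ofAdd w, hw, (hb _).symm.trans hwv⟩
  refine ⟨rfl, B, hdet, ?_⟩
  have hre : Matrix.reindex (finCongr rfl) (finCongr rfl) Ab = Ab := rfl
  rw [hre]
  refine hβ.imp (fun h => ⟨?_, himage _ h.2⟩) (fun h => ⟨?_, himage _ h.2⟩)
  · have key : QMat B * A = Ab * QMat B := by
      refine matrix_eq_of_finiteIndex hL fun v hv => ?_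
      have h1 : ZtoQ nb (β (Multiplicative.ofAdd (θ ⟨v, hv⟩ : Fin nb → ℤ))).toAdd =
        Ab.mulVec (ZtoQ nb (β (Multiplicative.ofAdd v)).toAdd) := h.1 ⟨Multiplicative.ofAdd v, hv⟩
      rw [hβB, hβB, hθ] at h1
      simpa using h1
    rw [key, Matrix.mul_nonsing_inv_cancel_right _ _ hQdet]
  · have key : Ab * (QMat B * A) = QMat B := by
      refine matrix_eq_of_finiteIndex hL fun v hv => ?_
      have h0 := congrArg (mulVecAut Ab hAb) (h.1 ⟨Multiplicative.ofAdd v, hv⟩)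
      rw [MulAut.apply_inv_self] at h0
      have h1 : Ab.mulVec (ZtoQ nb (β (Multiplicative.ofAdd (θ ⟨v, hv⟩ : Fin nb → ℤ))).toAdd) =
        ZtoQ nb (β (Multiplicative.ofAdd v)).toAdd := h0
      rw [hβB, hβB, hθ] at h1
      simpa using h1
    nth_rewrite 1 [← key]
    rw [← Matrix.mul_assoc, Matrix.mul_nonsing_inv_cancel_right _ _ hA,
      Matrix.mul_nonsing_inv_cancel_right _ _ hQdet]
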